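/- arXiv:1501.07506 — 3 statements merged into one kernel-verified Lean document; each statement's English description precedes it below -/
import Mathlib

section
/- In the areal interpolation setup at target level, the bias of the dasymetric predictor satisfies E(Ŷ^DAX_T − Y_T) = α·|S|·(x_T/x_S − |T|/|S|), where Ŷ^DAX_T = (x_T/x_S)·Y_S; in particular this bias has the opposite sign to the bias β·x_S·(|T|/|S| − x_T/x_S) of the areal weighting predictor. -/
open MeasureTheory ProbabilityTheory

/-- The series of the mean of a Poisson distribution. -/
lemma hasSum_poisson_mul_cast (r : NNReal) :
    HasSum (fun n : ℕ ↦ (Real.exp (-r) * (r : ℝ) ^ n / n.factorial) * (n : ℝ)) r := by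
  rw [← hasSum_nat_add_iff' 1]
  simp only [Finset.range_one, Finset.sum_singleton, Nat.cast_zero, mul_zero, sub_zero]
  have h := (hasSum_one_poissonMeasure r).mul_left (r : ℝ)
  rw [mul_one] at h
  refine h.congr_fun ?_
  intro n
  rw [Nat.factorial_succ]
  push_cast
  field_simp
  ring

lemma integrable_cast_poissonMeasure (r : NNReal) :
    Integrable (fun n : ℕ ↦ (n : ℝ)) (poissonMeasure r) := by
  rw [integrable_poissonMeasure_iff]
  simpa using (hasSum_poisson_mul_cast r).summable

lemma integral_cast_poissonMeasure (r : NNReal) :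
    ∫ n : ℕ, (n : ℝ) ∂(poissonMeasure r) = r := by
  rw [integral_poissonMeasure]
  simpa using (hasSum_poisson_mul_cast r).tsum_eq

section PoissonLaw

variable {Ω : Type*} {mΩ : MeasurableSpace Ω} {μ : Measure Ω} {Y : Ω → ℕ} {r : NNReal}

lemma integrable_of_map_eq_poissonMeasure (hY : Measurable Y)
    (h : μ.map Y = poissonMeasure r) : Integrable (fun ω ↦ (Y ω : ℝ)) μ :=
  (h ▸ integrable_cast_poissonMeasure r :
    Integrable (fun n : ℕ ↦ (n : ℝ)) (μ.map Y)).comp_measurable hY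

lemma integral_of_map_eq_poissonMeasure (hY : Measurable Y)
    (h : μ.map Y = poissonMeasure r) : ∫ ω, (Y ω : ℝ) ∂μ = r := by
  rw [← integral_cast_poissonMeasure r, ← h, integral_map hY.aemeasurable]
  exact (measurable_of_countable _).aestronglyMeasurable

end PoissonLaw

/-- The bias of the dasymetric predictor satisfies
`E(Ŷ^DAX_T − Y_T) = α·|S|·(x_T/x_S − |T|/|S|)`; in particular it has the opposite sign
to the bias `β·x_S·(|T|/|S| − x_T/x_S)` of the areal weighting predictor. -/
theorem bias_dasymetric
    {Ω : Type*} [MeasureSpace Ω] [IsProbabilityMeasure (ℙ : Measure Ω)]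
    (α β aS xS aT xT : ℝ)
    (hα : 0 ≤ α) (hβ : 0 ≤ β) (haS : 0 < aS) (hxS : 0 < xS)
    (haT0 : 0 ≤ aT) (haTS : aT ≤ aS) (hxT0 : 0 ≤ xT) (hxTS : xT ≤ xS)
    (hlamT : 0 < α * aT + β * xT)
    (hlamST : 0 < (α * aS + β * xS) - (α * aT + β * xT))
    (YT YSc : Ω → ℕ) (hYTm : Measurable YT) (hYScm : Measurable YSc)
    (hindep : IndepFun YT YSc)
    (hYTd : Measure.map YT ℙ = poissonMeasure (α * aT + β * xT).toNNReal)
    (hYScd : Measure.map YSc ℙ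
      = poissonMeasure ((α * aS + β * xS) - (α * aT + β * xT)).toNNReal) :
    ∫ ω, ((xT / xS) * ((YT ω : ℝ) + (YSc ω : ℝ)) - (YT ω : ℝ)) ∂ℙ
        = α * aS * (xT / xS - aT / aS) ∧
      (∫ ω, ((xT / xS) * ((YT ω : ℝ) + (YSc ω : ℝ)) - (YT ω : ℝ)) ∂ℙ)
        * (β * xS * (aT / aS - xT / xS)) ≤ 0 := by
  have hbias : ∫ ω, ((xT / xS) * ((YT ω : ℝ) + (YSc ω : ℝ)) - (YT ω : ℝ)) ∂ℙ
      = α * aS * (xT / xS - aT / aS) := by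
    have iT := integrable_of_map_eq_poissonMeasure hYTm hYTd
    have iS := integrable_of_map_eq_poissonMeasure hYScm hYScd
    have iTS : Integrable (fun ω ↦ xT / xS * ((YT ω : ℝ) + (YSc ω : ℝ))) ℙ :=
      (iT.add iS).const_mul _
    rw [integral_sub iTS iT, integral_const_mul, integral_add iT iS,
      integral_of_map_eq_poissonMeasure hYTm hYTd, integral_of_map_eq_poissonMeasure hYScm hYScd,
      Real.coe_toNNReal _ hlamT.le, Real.coe_toNNReal _ hlamST.le]
    field_simp
    ring
  refine ⟨hbias, ?_⟩
  rw [hbias]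
  have h : 0 ≤ α * aS * (β * xS) * (xT / xS - aT / aS) ^ 2 := by positivity
  linarith
end

section
/- In the areal interpolation setup at target level, the variance of the areal weighting prediction error satisfies Var(Ŷ^DAW_T − Y_T) = β·x_S·(|T|/|S| − x_T/x_S)² + β·x_T·(1 − x_T/x_S) + α·|T|·(1 − |T|/|S|). -/
open MeasureTheory ProbabilityTheory

open scoped NNReal Nat in
/-- The Stein–Chen identity `E[N g(N)] = r E[g(N + 1)]` for a Poisson variable `N` of mean `r`,
at the level of sums. -/
lemma hasSum_poisson_natCast_mul (r : ℝ≥0) {g : ℕ → ℝ} {s : ℝ}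
    (h : HasSum (fun n : ℕ ↦ Real.exp (-r) * r ^ n / n ! * g (n + 1)) s) :
    HasSum (fun n : ℕ ↦ Real.exp (-r) * r ^ n / n ! * (n * g n)) (r * s) := by
  rw [← hasSum_nat_add_iff' 1]
  simp only [Finset.sum_range_one, Nat.cast_zero, zero_mul, mul_zero, sub_zero]
  convert! h.mul_left (r : ℝ) using 2 with n
  rw [Nat.factorial_succ]
  push_cast
  field_simp
  ring

open scoped NNReal Nat in
lemma hasSum_poisson_natCast (r : ℝ≥0) :
    HasSum (fun n : ℕ ↦ Real.exp (-r) * r ^ n / n ! * (n : ℝ)) r := by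
  simpa using hasSum_poisson_natCast_mul r (g := fun _ ↦ 1) (s := 1)
    (by simpa using hasSum_one_poissonMeasure r)

open scoped NNReal Nat in
lemma hasSum_poisson_natCast_sq (r : ℝ≥0) :
    HasSum (fun n : ℕ ↦ Real.exp (-r) * r ^ n / n ! * (n : ℝ) ^ 2) (r * (r + 1)) := by
  simpa [sq] using hasSum_poisson_natCast_mul r (g := fun n ↦ n) (s := r + 1)
    (by simpa [mul_add] using (hasSum_poisson_natCast r).add (hasSum_one_poissonMeasure r))

open scoped NNReal in
lemma integral_natCast_poissonMeasure (r : ℝ≥0) : ∫ n : ℕ, (n : ℝ) ∂poissonMeasure r = r := by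
  rw [integral_poissonMeasure]
  exact (hasSum_poisson_natCast r).tsum_eq

open scoped NNReal in
lemma integral_natCast_sq_poissonMeasure (r : ℝ≥0) :
    ∫ n : ℕ, (n : ℝ) ^ 2 ∂poissonMeasure r = r * (r + 1) := by
  rw [integral_poissonMeasure]
  exact (hasSum_poisson_natCast_sq r).tsum_eq

open scoped NNReal in
lemma memLp_two_natCast_poissonMeasure (r : ℝ≥0) :
    MemLp (fun n : ℕ ↦ (n : ℝ)) 2 (poissonMeasure r) := by
  rw [memLp_two_iff_integrable_sq (by fun_prop), integrable_poissonMeasure_iff]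
  simpa using (hasSum_poisson_natCast_sq r).summable

open scoped NNReal in
lemma variance_natCast_poissonMeasure (r : ℝ≥0) :
    variance (fun n : ℕ ↦ (n : ℝ)) (poissonMeasure r) = r := by
  rw [variance_eq_sub (memLp_two_natCast_poissonMeasure r), integral_natCast_poissonMeasure]
  simp only [Pi.pow_apply]
  rw [integral_natCast_sq_poissonMeasure]
  ring


/-- The variance of the areal weighting prediction error satisfies
`Var(Ŷ^DAW_T − Y_T) = β·x_S·(|T|/|S| − x_T/x_S)² + β·x_T·(1 − x_T/x_S) + α·|T|·(1 − |T|/|S|)`. -/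
theorem variance_areal_weighting
    {Ω : Type*} [MeasureSpace Ω] [IsProbabilityMeasure (ℙ : Measure Ω)]
    (α β aS xS aT xT : ℝ)
    (hα : 0 ≤ α) (hβ : 0 ≤ β) (haS : 0 < aS) (hxS : 0 < xS)
    (haT0 : 0 ≤ aT) (haTS : aT ≤ aS) (hxT0 : 0 ≤ xT) (hxTS : xT ≤ xS)
    (hlamT : 0 < α * aT + β * xT)
    (hlamST : 0 < (α * aS + β * xS) - (α * aT + β * xT))
    (YT YSc : Ω → ℕ) (hYTm : Measurable YT) (hYScm : Measurable YSc)
    (hindep : IndepFun YT YSc)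
    (hYTd : Measure.map YT ℙ = poissonMeasure (α * aT + β * xT).toNNReal)
    (hYScd : Measure.map YSc ℙ
      = poissonMeasure ((α * aS + β * xS) - (α * aT + β * xT)).toNNReal) :
    variance (fun ω => (aT / aS) * ((YT ω : ℝ) + (YSc ω : ℝ)) - (YT ω : ℝ)) ℙ
      = β * xS * (aT / aS - xT / xS) ^ 2 + β * xT * (1 - xT / xS)
        + α * aT * (1 - aT / aS) := by
  have memLp_of_map {Y : Ω → ℕ} {r : NNReal} (hY : Measurable Y)
      (h : Measure.map Y ℙ = poissonMeasure r) : MemLp (fun ω ↦ (Y ω : ℝ)) 2 ℙ :=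
    (h ▸ memLp_two_natCast_poissonMeasure r :
      MemLp (fun n : ℕ ↦ (n : ℝ)) 2 (Measure.map Y ℙ)).comp_of_map hY.aemeasurable
  have variance_of_map {Y : Ω → ℕ} {r : NNReal} (hY : Measurable Y)
      (h : Measure.map Y ℙ = poissonMeasure r) : variance (fun ω ↦ (Y ω : ℝ)) ℙ = r := by
    rw [← variance_natCast_poissonMeasure r, ← h, variance_map (by fun_prop) hY.aemeasurable]
    rfl
  have hsplit : (fun ω ↦ (aT / aS) * ((YT ω : ℝ) + (YSc ω : ℝ)) - (YT ω : ℝ))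
      = fun ω ↦ (aT / aS - 1) * (YT ω : ℝ) + (aT / aS) * (YSc ω : ℝ) := by
    ext ω
    ring
  have hind : IndepFun (fun ω ↦ (aT / aS - 1) * (YT ω : ℝ)) (fun ω ↦ (aT / aS) * (YSc ω : ℝ)) :=
    hindep.comp (φ := fun n : ℕ ↦ (aT / aS - 1) * (n : ℝ)) (ψ := fun n : ℕ ↦ (aT / aS) * (n : ℝ))
      (by fun_prop) (by fun_prop)
  rw [hsplit, hind.variance_fun_add ((memLp_of_map hYTm hYTd).const_mul _)
      ((memLp_of_map hYScm hYScd).const_mul _), variance_const_mul, variance_const_mul,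
    variance_of_map hYTm hYTd, variance_of_map hYScm hYScd, Real.coe_toNNReal _ hlamT.le,
    Real.coe_toNNReal _ hlamST.le]
  field_simp
  ring
end

section
/- Region-level pycnophylactic property of the Poisson regression predictor: let Z_1, …, Z_n ∈ ℝ² and y_1, …, y_n ∈ ℝ, and suppose γ̂ ∈ ℝ² satisfies γ̂'Z_i ≠ 0 for all i together with the score equation Σ_{i=1}^n (Z_i/(γ̂'Z_i))·y_i − Z_i = 0 (an equation in ℝ²). Then Σ_{i=1}^n γ̂'Z_i = Σ_{i=1}^n y_i; that is, the sum over all sources of the regression predictions γ̂'Z_i equals the total observed count. -/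
/-- Region-level pycnophylactic property of the Poisson regression
predictor: if `γ̂ ∈ ℝ²` satisfies `γ̂'Zᵢ ≠ 0` for all `i` together with the score equation
`Σᵢ (Zᵢ/(γ̂'Zᵢ))·yᵢ − Zᵢ = 0`, then `Σᵢ γ̂'Zᵢ = Σᵢ yᵢ`. -/
theorem regression_pycnophylactic_region
    (n : ℕ) (Z : Fin n → ℝ × ℝ) (y : Fin n → ℝ) (γ : ℝ × ℝ)
    (hne : ∀ i, γ.1 * (Z i).1 + γ.2 * (Z i).2 ≠ 0)
    (hscore : ∑ i, ((y i / (γ.1 * (Z i).1 + γ.2 * (Z i).2)) • Z i - Z i) = 0) :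
    ∑ i, (γ.1 * (Z i).1 + γ.2 * (Z i).2) = ∑ i, y i := by
  have h₁ := congrArg Prod.fst hscore
  have h₂ := congrArg Prod.snd hscore
  simp only [Prod.fst_sum, Prod.snd_sum, Prod.fst_sub, Prod.snd_sub, Prod.smul_fst,
    Prod.smul_snd, Prod.fst_zero, Prod.snd_zero, smul_eq_mul] at h₁ h₂
  rw [eq_comm, ← sub_eq_zero, ← Finset.sum_sub_distrib]
  calc ∑ i, (y i - (γ.1 * (Z i).1 + γ.2 * (Z i).2))
      = γ.1 * ∑ i, (y i / (γ.1 * (Z i).1 + γ.2 * (Z i).2) * (Z i).1 - (Z i).1)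
        + γ.2 * ∑ i, (y i / (γ.1 * (Z i).1 + γ.2 * (Z i).2) * (Z i).2 - (Z i).2) := by
        rw [Finset.mul_sum, Finset.mul_sum, ← Finset.sum_add_distrib]
        refine Finset.sum_congr rfl fun i _ => ?_
        linear_combination -div_mul_cancel₀ (y i) (hne i)
    _ = 0 := by rw [h₁, h₂, mul_zero, mul_zero, add_zero]
end
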